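/- Let U = (D, m, E) ∈ G with primitive variables (ρ, u, p), Γ ∈ (1,2], and let F_i(U) = (D u_i, m u_i + p e_i, (E+p) u_i) be the i-th directional flux. If α ≥ λ_i^{(4)}(U), then αU - F_i(U) ∈ G, i.e., the state (D^α, m^α, E^α) = αU - F_i(U) satisfies D^α > 0, E^α > 0 and (E^α)² - (D^α)² - |m^α|² > 0. -/

import Mathlib

set_option maxHeartbeats 4000000 in
theorem core_adm (Γ ρ a b p g q c α R : ℝ)
    (hΓ1 : 1 < Γ) (hΓ2 : Γ ≤ 2) (hρ : 0 < ρ) (hp : 0 < p)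
    (hu : a ^ 2 + b ^ 2 < 1) (hg : 0 < g) (hgw : g ^ 2 * (1 - (a ^ 2 + b ^ 2)) = 1)
    (hq : q * (Γ - 1) = ρ * (Γ - 1) + Γ * p) (hc : 0 ≤ c) (hcq : c ^ 2 * q = Γ * p)
    (hR : 0 ≤ R) (hR2 : R ^ 2 = 1 - a ^ 2 - c ^ 2 * b ^ 2)
    (hα : (a * (1 - c ^ 2) + c / g * R) / (1 - c ^ 2 * (a ^ 2 + b ^ 2)) ≤ α) :
    0 < α - a ∧ 0 < α * (q * g ^ 2 - p) - q * g ^ 2 * a ∧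
    0 < (α * (q * g ^ 2 - p) - q * g ^ 2 * a) ^ 2 - (ρ * g * (α - a)) ^ 2
      - ((q * g ^ 2 * a * (α - a) - p) ^ 2 + (q * g ^ 2 * b * (α - a)) ^ 2) := by
  have hΓ0 : 0 < Γ - 1 := by linarith
  obtain ⟨w, hw⟩ : ∃ w, w = 1 - (a ^ 2 + b ^ 2) := ⟨_, rfl⟩
  have hw0 : 0 < w := by linarith
  have hq2 : 2 * p < q := by
    have : 0 < (q - 2 * p) * (Γ - 1) := by
      have h1 := mul_pos hρ hΓ0
      have h2 := mul_nonneg hp.le (by linarith : 0 ≤ 2 - Γ)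
      linarith
    have := (pos_iff_pos_of_mul_pos this).2 hΓ0
    linarith
  have hq0 : 0 < q := by linarith
  have hqG : 0 < q - Γ * p := by
    have : 0 < (q - Γ * p) * (Γ - 1) := by
      have : (q - Γ * p) * (Γ - 1) = ρ * (Γ - 1) + Γ * p * (2 - Γ) := by
        linear_combination hq
      rw [this]
      have h1 := mul_pos hρ hΓ0
      have h2 : 0 ≤ Γ * p * (2 - Γ) :=
        mul_nonneg (mul_nonneg (by linarith) hp.le) (by linarith)
      linarith
    exact (pos_iff_pos_of_mul_pos this).2 hΓ0
  have hcp : 0 < c ^ 2 := by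
    have : 0 < c ^ 2 * q := by rw [hcq]; positivity
    exact (pos_iff_pos_of_mul_pos this).2 hq0
  have hc0 : 0 < c := lt_of_le_of_ne hc (by rintro rfl; norm_num at hcp)
  have hc1 : c ^ 2 < 1 := by
    by_contra hcon
    push Not at hcon
    nlinarith
  have ha1 : a ^ 2 < 1 := by nlinarith [sq_nonneg b]
  have hP : 0 < 1 - c ^ 2 * (a ^ 2 + b ^ 2) := by nlinarith [sq_nonneg a, sq_nonneg b]
  rw [div_le_iff₀ hP] at hα
  obtain ⟨S, hS⟩ : ∃ S, S = c / g * R := ⟨_, rfl⟩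
  rw [← hS] at hα
  have hS0 : 0 ≤ S := by rw [hS]; positivity
  rw [← hw] at hgw
  have hS2 : S ^ 2 = c ^ 2 * w * (1 - a ^ 2 - c ^ 2 * b ^ 2) := by
    rw [hS, ← hR2, mul_pow, div_pow]
    field_simp
    linear_combination (-R ^ 2) * hgw
  have hSa : a * c ^ 2 * w < S := by
    apply lt_of_pow_lt_pow_left₀ 2 hS0
    rw [hS2]
    have h1 : 0 < (1 - a ^ 2 - c ^ 2 * b ^ 2) - a ^ 2 * c ^ 2 * w := by
      have e1 : (1 - a ^ 2 - c ^ 2 * b ^ 2) - a ^ 2 * c ^ 2 * w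
        = w * (1 - a ^ 2) + (1 - c ^ 2) * (b ^ 2 + a ^ 2 * w) := by rw [hw]; ring
      rw [e1]
      have := mul_pos hw0 (sub_pos.2 ha1)
      have : 0 ≤ (1 - c ^ 2) * (b ^ 2 + a ^ 2 * w) :=
        mul_nonneg (by linarith) (by positivity)
      linarith
    have h2 := mul_pos (mul_pos hcp hw0) h1
    linarith
  have hs : 0 < α - a := by
    have : 0 < (α - a) * (1 - c ^ 2 * (a ^ 2 + b ^ 2)) := by
      rw [hw] at hSa; linarith
    exact (pos_iff_pos_of_mul_pos this).2 hP
  have hf : 0 ≤ (α - a) ^ 2 * (1 - c ^ 2) - c ^ 2 * (1 - α ^ 2) * w := by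
    have h1 : S ^ 2 ≤ (α * (1 - c ^ 2 * (a ^ 2 + b ^ 2)) - a * (1 - c ^ 2)) ^ 2 :=
      pow_le_pow_left₀ hS0 (by linarith) 2
    have h2 : 0 ≤ (1 - c ^ 2 * (a ^ 2 + b ^ 2)) *
        ((α - a) ^ 2 * (1 - c ^ 2) - c ^ 2 * (1 - α ^ 2) * w) := by
      have e : (1 - c ^ 2 * (a ^ 2 + b ^ 2)) *
        ((α - a) ^ 2 * (1 - c ^ 2) - c ^ 2 * (1 - α ^ 2) * w)
        = (α * (1 - c ^ 2 * (a ^ 2 + b ^ 2)) - a * (1 - c ^ 2)) ^ 2 - S ^ 2 := by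
        rw [hS2, hw]; ring
      rw [e]; linarith
    exact nonneg_of_mul_nonneg_right h2 hP
  -- multiply by q and by g^2
  have hf2 : Γ * p * (1 - α ^ 2) ≤ (α - a) ^ 2 * g ^ 2 * (q - Γ * p) := by
    have h1 := mul_nonneg (mul_nonneg (sq_nonneg g) hq0.le) hf
    have e : g ^ 2 * q * ((α - a) ^ 2 * (1 - c ^ 2) - c ^ 2 * (1 - α ^ 2) * w)
      = (α - a) ^ 2 * g ^ 2 * (q - Γ * p) - Γ * p * (1 - α ^ 2) := by
      linear_combination (-(g ^ 2 * (α - a) ^ 2) - (1 - α ^ 2)) * hcq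
        - c ^ 2 * q * (1 - α ^ 2) * hgw
    linarith
  have hA : 0 < Γ * (q ^ 2 - 2 * q * p - ρ ^ 2) - p * (q - Γ * p) := by
    obtain ⟨k, hk⟩ : ∃ k, k = 1 / (Γ - 1) := ⟨_, rfl⟩
    have hk1 : 1 ≤ k := by rw [hk, le_div_iff₀ hΓ0]; linarith
    have hG : Γ = 1 + 1 / k := by rw [hk]; field_simp; ring
    have hqk : q = ρ + (k + 1) * p := by
      apply mul_right_cancel₀ hΓ0.ne'
      rw [hq, hk]; field_simp; ring
    have e : Γ * (q ^ 2 - 2 * q * p - ρ ^ 2) - p * (q - Γ * p)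
       = (2 * Γ * k - 1) * ρ * p + (Γ * ((k + 1) * (k - 1)) - (k + 1 - Γ)) * p ^ 2 := by
      rw [hqk]; ring
    have hGk : Γ * k = k + 1 := by rw [hG]; field_simp
    have e2 : Γ * ((k + 1) * (k - 1)) - (k + 1 - Γ) = (k + 1) * (k - 1) := by
      linear_combination k * hGk
    rw [e, e2]
    have h1 : 0 < 2 * Γ * k - 1 := by linarith
    have h2 : 0 ≤ (k + 1) * (k - 1) := mul_nonneg (by linarith) (by linarith)
    positivity
  have hQ : 0 < (α * (q * g ^ 2 - p) - q * g ^ 2 * a) ^ 2 - (ρ * g * (α - a)) ^ 2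
      - ((q * g ^ 2 * a * (α - a) - p) ^ 2 + (q * g ^ 2 * b * (α - a)) ^ 2) := by
    have e : (α * (q * g ^ 2 - p) - q * g ^ 2 * a) ^ 2 - (ρ * g * (α - a)) ^ 2
      - ((q * g ^ 2 * a * (α - a) - p) ^ 2 + (q * g ^ 2 * b * (α - a)) ^ 2)
      = (α - a) ^ 2 * g ^ 2 * (q ^ 2 - 2 * q * p - ρ ^ 2) - p ^ 2 * (1 - α ^ 2) := by
      rw [hw] at hgw
      linear_combination (q ^ 2 * g ^ 2 * (α - a) ^ 2) * hgw
    rw [e]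
    have h1 := mul_pos (by positivity : 0 < (α - a) ^ 2 * g ^ 2) hA
    have h2 := mul_le_mul_of_nonneg_left hf2 hp.le
    have : 0 < Γ * ((α - a) ^ 2 * g ^ 2 * (q ^ 2 - 2 * q * p - ρ ^ 2) - p ^ 2 * (1 - α ^ 2)) := by
      linarith
    exact (pos_iff_pos_of_mul_pos this).1 (by linarith)
  refine ⟨hs, ?_, hQ⟩
  by_contra hcon
  push Not at hcon
  have hab := abs_lt_of_sq_lt_sq (by linarith : a ^ 2 < 1 ^ 2) (by norm_num)
  obtain ⟨hal, hau⟩ := abs_lt.1 hab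
  have hW : p < q * g ^ 2 * (1 - a) := by
    have h1 : 1 ≤ g ^ 2 * ((1 - a) * (1 + a)) := by rw [hw] at hgw; linarith [mul_nonneg (sq_nonneg g) (sq_nonneg b)]
    have h2 : 0 < g ^ 2 * (1 - a) := mul_pos (by positivity) (by linarith)
    have h3 : 1 < g ^ 2 * (1 - a) * 2 := by
      linarith [mul_pos h2 (sub_pos.2 hau)]
    linarith [mul_pos hq0 (sub_pos.2 h3)]
  have hm : p - q * g ^ 2 * a * (α - a) ≤ -(α * (q * g ^ 2 - p) - q * g ^ 2 * a) := by
    apply le_of_abs_le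
    rw [← abs_of_nonneg (by linarith : 0 ≤ -(α * (q * g ^ 2 - p) - q * g ^ 2 * a))]
    apply sq_le_sq.1
    linarith [neg_sq (α * (q * g ^ 2 - p) - q * g ^ 2 * a), sq_nonneg (ρ * g * (α - a)), sq_nonneg (q * g ^ 2 * b * (α - a))]
  linarith [mul_lt_mul_of_pos_right hW hs, mul_pos hp (sub_pos.2 hau)]


set_option maxHeartbeats 4000000 in
/-- If `U = (D, m, E) ∈ G` (built from primitives `(ρ, u, p)`, `Γ ∈ (1,2]`) and
`α ≥ λ_i^{(4)}(U)`, then `αU - F_i(U) ∈ G`. -/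
theorem alphaU_sub_flux_admissible (Γ ρ u1 u2 p : ℝ)
    (γ e h cs D m1 m2 E ui ei1 ei2 lam4 α : ℝ)
    (hΓ1 : 1 < Γ) (hΓ2 : Γ ≤ 2) (hρ : 0 < ρ) (hp : 0 < p)
    (hu : u1 ^ 2 + u2 ^ 2 < 1)
    (hγ : γ = 1 / Real.sqrt (1 - (u1 ^ 2 + u2 ^ 2)))
    (he : e = p / ((Γ - 1) * ρ)) (hh : h = 1 + e + p / ρ)
    (hcs : cs = Real.sqrt (Γ * p / (ρ * h)))
    (hD : D = ρ * γ) (hm1 : m1 = ρ * h * γ ^ 2 * u1) (hm2 : m2 = ρ * h * γ ^ 2 * u2)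
    (hE : E = ρ * h * γ ^ 2 - p)
    (hi : (ui = u1 ∧ ei1 = 1 ∧ ei2 = 0) ∨ (ui = u2 ∧ ei1 = 0 ∧ ei2 = 1))
    (hlam4 : lam4 = (ui * (1 - cs ^ 2) +
        cs / γ * Real.sqrt (1 - ui ^ 2 - cs ^ 2 * ((u1 ^ 2 + u2 ^ 2) - ui ^ 2))) /
        (1 - cs ^ 2 * (u1 ^ 2 + u2 ^ 2)))
    (hα : lam4 ≤ α) :
    α * D - D * ui > 0 ∧
      α * E - (E + p) * ui > 0 ∧
      (α * E - (E + p) * ui) ^ 2 - (α * D - D * ui) ^ 2 -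
        ((α * m1 - (m1 * ui + p * ei1)) ^ 2 +
          (α * m2 - (m2 * ui + p * ei2)) ^ 2) > 0 := by
  have hΓ0 : 0 < Γ - 1 := by linarith
  have hw0 : 0 < 1 - (u1 ^ 2 + u2 ^ 2) := by linarith
  have hg : 0 < γ := by rw [hγ]; positivity
  have hgw : γ ^ 2 * (1 - (u1 ^ 2 + u2 ^ 2)) = 1 := by
    rw [hγ, div_pow, Real.sq_sqrt hw0.le]; field_simp
  have hq : ρ * h * (Γ - 1) = ρ * (Γ - 1) + Γ * p := by
    rw [hh, he]; field_simp; ring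
  have hh0 : 0 < h := by rw [hh, he]; positivity
  have hc : 0 ≤ cs := by rw [hcs]; positivity
  have hcq : cs ^ 2 * (ρ * h) = Γ * p := by
    rw [hcs, Real.sq_sqrt (by positivity)]; field_simp
  have hc1 : cs ^ 2 ≤ 1 := by
    have : 0 < (ρ * h - Γ * p) * (Γ - 1) := by
      have : (ρ * h - Γ * p) * (Γ - 1) = ρ * (Γ - 1) + Γ * p * (2 - Γ) := by
        linear_combination hq
      rw [this]
      have h1 := mul_pos hρ hΓ0
      have h2 : 0 ≤ Γ * p * (2 - Γ) :=
        mul_nonneg (mul_nonneg (by linarith) hp.le) (by linarith)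
      linarith
    have := (pos_iff_pos_of_mul_pos this).2 hΓ0
    have := mul_pos hρ hh0
    by_contra hcon
    push Not at hcon
    nlinarith
  rw [hlam4] at hα
  have hDp : 0 < D := by rw [hD]; positivity
  rcases hi with ⟨rfl, rfl, rfl⟩ | ⟨rfl, rfl, rfl⟩
  · have hr : 0 ≤ 1 - ui ^ 2 - cs ^ 2 * ((ui ^ 2 + u2 ^ 2) - ui ^ 2) := by
      nlinarith [sq_nonneg u2]
    obtain ⟨h1, h2, h3⟩ := core_adm Γ ρ ui u2 p γ (ρ * h) cs α _ hΓ1 hΓ2 hρ hp hu hg hgw hq hc hcq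
      (Real.sqrt_nonneg _) (by rw [Real.sq_sqrt hr]; ring) hα
    refine ⟨by linarith [mul_pos hDp h1], ?_, ?_⟩
    · rw [hE]; convert h2 using 1; ring
    · rw [hE, hD, hm1, hm2]; convert h3 using 1; ring
  · have hr : 0 ≤ 1 - ui ^ 2 - cs ^ 2 * ((u1 ^ 2 + ui ^ 2) - ui ^ 2) := by
      nlinarith [sq_nonneg u1]
    rw [add_comm (u1 ^ 2)] at hu hgw
    obtain ⟨h1, h2, h3⟩ := core_adm Γ ρ ui u1 p γ (ρ * h) cs α _ hΓ1 hΓ2 hρ hp hu hg hgw hq hc hcq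
      (Real.sqrt_nonneg _) (by rw [Real.sq_sqrt hr]; ring) (by rw [add_comm (ui ^ 2)]; exact hα)
    refine ⟨by linarith [mul_pos hDp h1], ?_, ?_⟩
    · rw [hE]; convert h2 using 1; ring
    · rw [hE, hD, hm1, hm2]; convert h3 using 1; ring
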